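/- arXiv:0707.0144 — 2 statements merged into one kernel-verified Lean document; each statement's English description precedes it below -/
import Mathlib

section
/- If A and B are diagonalizable matrices in SO(2N, ℂ) that are conjugate in O(2N, ℂ), and 1 occurs as an eigenvalue of A, then A and B are conjugate in SO(2N, ℂ). -/
open Matrix

/-- A matrix is diagonalizable if it is conjugate (by an invertible matrix)
to a diagonal matrix. -/
def Matrix.IsDiagonalizable {n : Type*} [Fintype n] [DecidableEq n]
    (A : Matrix n n ℂ) : Prop :=
  ∃ (P : (Matrix n n ℂ)ˣ) (d : n → ℂ),
    (↑P⁻¹ : Matrix n n ℂ) * A * (↑P : Matrix n n ℂ) = Matrix.diagonal d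

/-- The reflection in the hyperplane orthogonal to a vector `u` with `u ⬝ᵥ u ≠ 0`, for the
standard symmetric bilinear form. -/
def Matrix.orthogonalReflection {n K : Type*} [DecidableEq n] [Fintype n] [Field K]
    (u : n → K) : Matrix n n K :=
  1 - (2 / (u ⬝ᵥ u)) • vecMulVec u u

theorem Matrix.orthogonalReflection_transpose {n K : Type*} [DecidableEq n] [Fintype n] [Field K]
    (u : n → K) : (orthogonalReflection u)ᵀ = orthogonalReflection u := by
  simp [orthogonalReflection, transpose_vecMulVec]

theorem Matrix.orthogonalReflection_mul_self {n K : Type*} [DecidableEq n] [Fintype n] [Field K]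
    {u : n → K} (hu : u ⬝ᵥ u ≠ 0) :
    orthogonalReflection u * orthogonalReflection u = 1 := by
  ext i j
  simp only [orthogonalReflection, sub_mul, mul_sub, one_mul, mul_one, smul_mul_smul_comm,
    vecMulVec_mul_vecMulVec, vecMulVec_smul, sub_apply, smul_apply, smul_eq_mul]
  field_simp
  ring

theorem Matrix.det_orthogonalReflection {n K : Type*} [DecidableEq n] [Fintype n] [Field K]
    {u : n → K} (hu : u ⬝ᵥ u ≠ 0) : (orthogonalReflection u).det = -1 := by
  rw [orthogonalReflection, sub_eq_add_neg, ← neg_smul, ← smul_vecMulVec, vecMulVec_eq Unit,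
    det_one_add_replicateCol_mul_replicateRow, dotProduct_smul, smul_eq_mul]
  field_simp
  ring

/-- An orthogonal matrix that fixes `u` commutes with the reflection along `u`. -/
theorem Matrix.orthogonalReflection_mul_comm {n K : Type*} [DecidableEq n] [Fintype n] [Field K]
    {A : Matrix n n K} (hA : Aᵀ * A = 1) {u : n → K} (hu : A *ᵥ u = u) :
    orthogonalReflection u * A = A * orthogonalReflection u := by
  have hu' : u ᵥ* A = u := by
    rw [← mulVec_transpose]
    nth_rewrite 1 [← hu]
    rw [mulVec_mulVec, hA, one_mulVec]
  simp [orthogonalReflection, sub_mul, mul_sub, vecMulVec_mul, mul_vecMulVec, hu, hu']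

/-- The standard bilinear form is nondegenerate on the fixed space of a diagonalizable
orthogonal matrix. -/
theorem Matrix.IsDiagonalizable.exists_fixed_dotProduct_ne_zero {n : Type*} [Fintype n]
    [DecidableEq n] {A : Matrix n n ℂ} (hdiag : A.IsDiagonalizable) (hA : Aᵀ * A = 1)
    {v : n → ℂ} (hv0 : v ≠ 0) (hv : A *ᵥ v = v) :
    ∃ w : n → ℂ, A *ᵥ w = w ∧ v ⬝ᵥ w ≠ 0 := by
  obtain ⟨P, d, hP⟩ := hdiag
  obtain ⟨x, hx⟩ : ∃ x : n → ℂ, v ⬝ᵥ x ≠ 0 := by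
    by_contra! h
    exact hv0 (dotProduct_eq_zero v h)
  have hv' : v ᵥ* A = v := by
    rw [← mulVec_transpose]
    nth_rewrite 1 [← hv]
    rw [mulVec_mulVec, hA, one_mulVec]
  have hAP : A * (P : Matrix n n ℂ) = P * diagonal d := by
    rw [← hP, ← mul_assoc, ← mul_assoc, Units.mul_inv, one_mul]
  let S : Matrix n n ℂ := P * diagonal (fun i => (d i - 1)⁻¹) * (P⁻¹ : (Matrix n n ℂ)ˣ)
  have hS : (A - 1) * (1 - (A - 1) * S) = 0 := by
    have hAP' : (A - 1) * (P : Matrix n n ℂ) = P * diagonal (fun i => d i - 1) := by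
      rw [sub_mul, hAP, one_mul, ← diagonal_sub, mul_sub, diagonal_one, mul_one]
    have key : diagonal (fun i => d i - 1) * (diagonal (fun i => d i - 1) *
        diagonal (fun i => (d i - 1)⁻¹)) = diagonal (fun i => d i - 1) := by
      simp only [diagonal_mul_diagonal]
      congr 1
      ext i
      by_cases h : d i - 1 = 0
      · simp [h]
      · field_simp
    have h1 : (A - 1) * ((A - 1) * S) = A - 1 := by
      calc (A - 1) * ((A - 1) * S)
          = (A - 1) * ((A - 1) * P) * diagonal (fun i => (d i - 1)⁻¹) *
              (P⁻¹ : (Matrix n n ℂ)ˣ) := by simp only [S, mul_assoc]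
        _ = P * (diagonal (fun i => d i - 1) * (diagonal (fun i => d i - 1) *
              diagonal (fun i => (d i - 1)⁻¹))) * (P⁻¹ : (Matrix n n ℂ)ˣ) := by
            rw [hAP', ← mul_assoc (A - 1), hAP']
            simp only [mul_assoc]
        _ = A - 1 := by rw [key, ← hAP', mul_assoc, Units.mul_inv, mul_one]
    rw [mul_sub, h1, mul_one, sub_self]
  refine ⟨(1 - (A - 1) * S) *ᵥ x, ?_, ?_⟩
  · rw [← sub_eq_zero]
    calc A *ᵥ (1 - (A - 1) * S) *ᵥ x - (1 - (A - 1) * S) *ᵥ x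
        = ((A - 1) * (1 - (A - 1) * S)) *ᵥ x := by
          rw [← mulVec_mulVec, sub_mulVec A, one_mulVec]
      _ = 0 := by rw [hS, zero_mulVec]
  · have h0 : v ᵥ* (A - 1) = 0 := by rw [vecMul_sub, hv', vecMul_one, sub_self]
    rwa [dotProduct_mulVec, vecMul_sub, ← vecMul_vecMul, h0, zero_vecMul, vecMul_one, sub_zero]

/-- A diagonalizable orthogonal matrix with eigenvalue `1` fixes a nonisotropic vector. -/
theorem Matrix.IsDiagonalizable.exists_fixed_dotProduct_self_ne_zero {n : Type*} [Fintype n]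
    [DecidableEq n] {A : Matrix n n ℂ} (hdiag : A.IsDiagonalizable) (hA : Aᵀ * A = 1)
    {v : n → ℂ} (hv0 : v ≠ 0) (hv : A *ᵥ v = v) :
    ∃ u : n → ℂ, A *ᵥ u = u ∧ u ⬝ᵥ u ≠ 0 := by
  obtain ⟨w, hw, hvw⟩ := hdiag.exists_fixed_dotProduct_ne_zero hA hv0 hv
  by_contra! h
  have hsum := h (v + w) (by rw [mulVec_add, hv, hw])
  rw [add_dotProduct, dotProduct_add, dotProduct_add, h v hv, h w hw, dotProduct_comm w v] at hsum
  exact hvw (by linear_combination hsum / 2)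

/-- If `A` and `B` are diagonalizable matrices in `SO(2N, ℂ)` that are
conjugate in `O(2N, ℂ)`, and `1` occurs as an eigenvalue of `A`, then `A` and `B` are
conjugate in `SO(2N, ℂ)`. -/
theorem conjugate_in_SO_of_conjugate_in_O (N : ℕ)
    (A B : Matrix (Fin (2 * N)) (Fin (2 * N)) ℂ)
    (hAO : Aᵀ * A = 1) (hAdet : A.det = 1)
    (hBO : Bᵀ * B = 1) (hBdet : B.det = 1)
    (hAdiag : A.IsDiagonalizable) (hBdiag : B.IsDiagonalizable)
    (hconj : ∃ C : (Matrix (Fin (2 * N)) (Fin (2 * N)) ℂ)ˣ,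
      (↑C : Matrix (Fin (2 * N)) (Fin (2 * N)) ℂ)ᵀ * (↑C : Matrix (Fin (2 * N)) (Fin (2 * N)) ℂ) = 1 ∧
        B = (↑C⁻¹ : Matrix (Fin (2 * N)) (Fin (2 * N)) ℂ) * A * (↑C : Matrix (Fin (2 * N)) (Fin (2 * N)) ℂ))
    (heig : ∃ v : Fin (2 * N) → ℂ, v ≠ 0 ∧ A.mulVec v = v) :
    ∃ C : (Matrix (Fin (2 * N)) (Fin (2 * N)) ℂ)ˣ,
      (↑C : Matrix (Fin (2 * N)) (Fin (2 * N)) ℂ)ᵀ * (↑C : Matrix (Fin (2 * N)) (Fin (2 * N)) ℂ) = 1 ∧ (↑C : Matrix (Fin (2 * N)) (Fin (2 * N)) ℂ).det = 1 ∧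
        B = (↑C⁻¹ : Matrix (Fin (2 * N)) (Fin (2 * N)) ℂ) * A * (↑C : Matrix (Fin (2 * N)) (Fin (2 * N)) ℂ) := by
  obtain ⟨C, hC, hB⟩ := hconj
  have hdet : (C : Matrix (Fin (2 * N)) (Fin (2 * N)) ℂ).det = 1 ∨
      (C : Matrix (Fin (2 * N)) (Fin (2 * N)) ℂ).det = -1 := by
    have := congrArg det hC
    rw [det_mul, det_transpose, det_one] at this
    exact mul_self_eq_one_iff.mp this
  rcases hdet with hdet | hdet
  · exact ⟨C, hC, hdet, hB⟩
  obtain ⟨v, hv0, hv⟩ := heig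
  obtain ⟨u, hu, huu⟩ := hAdiag.exists_fixed_dotProduct_self_ne_zero hAO hv0 hv
  have hRR := orthogonalReflection_mul_self huu
  let R : (Matrix (Fin (2 * N)) (Fin (2 * N)) ℂ)ˣ :=
    ⟨orthogonalReflection u, orthogonalReflection u, hRR, hRR⟩
  have hRinv : ((R⁻¹ : (Matrix (Fin (2 * N)) (Fin (2 * N)) ℂ)ˣ) :
      Matrix (Fin (2 * N)) (Fin (2 * N)) ℂ) = orthogonalReflection u := rfl
  have hR : (R : Matrix (Fin (2 * N)) (Fin (2 * N)) ℂ) = orthogonalReflection u := rfl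
  refine ⟨R * C, ?_, ?_, ?_⟩
  · rw [Units.val_mul, hR, transpose_mul, orthogonalReflection_transpose, mul_assoc,
      ← mul_assoc (orthogonalReflection u), hRR, one_mul, hC]
  · rw [Units.val_mul, hR, det_mul, det_orthogonalReflection huu, hdet]
    norm_num
  · have hRAR : orthogonalReflection u * A * orthogonalReflection u = A := by
      rw [orthogonalReflection_mul_comm hAO hu, mul_assoc, hRR, mul_one]
    rw [_root_.mul_inv_rev, Units.val_mul, Units.val_mul, hRinv, hR, hB]
    nth_rewrite 1 [← hRAR]
    simp only [mul_assoc]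
end

section
/- Let 𝔤 be a complex semisimple Lie algebra, 𝔱 a Cartan subalgebra, Δ a base of the root system, and τ an automorphism of 𝔤 preserving 𝔱 and permuting the set of positive roots. For each positive root β set V(β) = 𝔤_β ⊕ 𝔤_{−β}. Then the determinant of the restriction of τ to V = ⊕_{β>0} V(β) equals 1, so det(τ on 𝔤) equals det(τ restricted to 𝔱). -/
/-- The determinant of an endomorphism that is block diagonal with respect to `M ≃ E × F`. -/
lemma LinearMap.det_eq_mul_of_comp_prod_equiv {K E F M : Type*} [Field K]
    [AddCommGroup E] [Module K E] [Module.Finite K E]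
    [AddCommGroup F] [Module K F] [Module.Finite K F] [AddCommGroup M] [Module K M]
    (j : (E × F) ≃ₗ[K] M) (f : M →ₗ[K] M) (a : E →ₗ[K] E) (b : F →ₗ[K] F)
    (h : ∀ x y, f (j (x, y)) = j (a x, b y)) :
    LinearMap.det f = LinearMap.det a * LinearMap.det b := by
  rw [← LinearMap.det_prodMap, ← LinearMap.det_conj (a.prodMap b) j]
  congr 1
  ext m
  obtain ⟨⟨x, y⟩, rfl⟩ := j.surjective m
  simp [h]

/-- The restriction of an endomorphism to the sum of two disjoint invariant subspaces has
determinant the product of the determinants on the two subspaces. -/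
lemma LinearMap.det_restrict_sup_eq_mul {K M : Type*} [Field K] [AddCommGroup M] [Module K M]
    [Module.Finite K M] (f : M →ₗ[K] M) {p q r : Submodule K M} (hpq : Disjoint p q)
    (hr : p ⊔ q = r) (hp : ∀ x ∈ p, f x ∈ p) (hq : ∀ x ∈ q, f x ∈ q) (hfr : ∀ x ∈ r, f x ∈ r) :
    LinearMap.det (f.restrict hfr) =
      LinearMap.det (f.restrict hp) * LinearMap.det (f.restrict hq) := by
  subst hr
  let c : (p × q) →ₗ[K] ↥(p ⊔ q) :=
    (Submodule.inclusion le_sup_left).coprod (Submodule.inclusion le_sup_right)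
  have hc (x : p × q) : (c x : M) = x.1 + x.2 := by simp [c]
  have hinj : Function.Injective c := by
    rw [← LinearMap.ker_eq_bot, LinearMap.ker_eq_bot']
    rintro ⟨x, y⟩ hxy
    have h0 : (x : M) + y = 0 := by rw [← hc (x, y), hxy]; rfl
    have hx : (x : M) = 0 := by
      refine Submodule.disjoint_def.mp hpq x x.2 ?_
      rw [eq_neg_of_add_eq_zero_left h0]
      exact q.neg_mem y.2
    have hy : (y : M) = 0 := by simpa [hx] using h0
    simpa using And.intro hx hy
  have hsurj : Function.Surjective c := by
    rintro ⟨z, hz⟩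
    obtain ⟨x, hx, y, hy, rfl⟩ := Submodule.mem_sup.mp hz
    exact ⟨(⟨x, hx⟩, ⟨y, hy⟩), Subtype.ext (hc _)⟩
  refine LinearMap.det_eq_mul_of_comp_prod_equiv (LinearEquiv.ofBijective c ⟨hinj, hsurj⟩) _ _ _
    fun x y ↦ Subtype.ext ?_
  change f (c (x, y)) = c (f.restrict hp x, f.restrict hq y)
  simp [hc]

/-- Two endomorphisms which jointly preserve a perfect pairing have inverse determinants. -/
lemma LinearMap.IsPerfPair.det_mul_det_eq_one {K E F : Type*} [Field K]
    [AddCommGroup E] [Module K E] [AddCommGroup F] [Module K F] [Module.Finite K F]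
    (B : E →ₗ[K] F →ₗ[K] K) [B.IsPerfPair] (f : E →ₗ[K] E) (g : F →ₗ[K] F)
    (h : ∀ x y, B (f x) (g y) = B x y) :
    LinearMap.det f * LinearMap.det g = 1 := by
  rw [← LinearMap.det_dualMap g, ← LinearMap.det_conj f B.toPerfPair, mul_comm,
    ← LinearMap.det_comp]
  convert LinearMap.det_id
  ext φ y
  obtain ⟨x, rfl⟩ := B.toPerfPair.surjective φ
  simp [h]

/-- A bilinear form vanishing on the members of two families of submodules vanishes on their
suprema. -/
lemma LinearMap.apply_eq_zero_of_mem_iSup {K M N : Type*} [CommRing K] [AddCommGroup M] [Module K M]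
    [AddCommGroup N] [Module K N] {ι κ : Sort*} (B : M →ₗ[K] N →ₗ[K] K)
    {s : ι → Submodule K M} {t : κ → Submodule K N}
    (h : ∀ i j, ∀ x ∈ s i, ∀ y ∈ t j, B x y = 0) {x : M} (hx : x ∈ ⨆ i, s i) {y : N}
    (hy : y ∈ ⨆ j, t j) : B x y = 0 := by
  have hs : ⨆ i, s i ≤ LinearMap.ker (B.flip y) := by
    refine iSup_le fun i x hx ↦ ?_
    have ht : ⨆ j, t j ≤ LinearMap.ker (B x) := iSup_le fun j y hy ↦ h i j x hx y hy
    exact ht hy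
  exact hs hx

/-- If a nondegenerate form vanishes on `P × T` and on `P × P`, and `T`, `P`, `N` together span,
then it pairs `P` with `N` without left kernel. -/
lemma LinearMap.SeparatingLeft.injective_domRestrict₁₂ {K M : Type*} [CommRing K] [AddCommGroup M]
    [Module K M] {B : M →ₗ[K] M →ₗ[K] K} (hB : B.SeparatingLeft) {T P N : Submodule K M}
    (htop : T ⊔ (P ⊔ N) = ⊤) (hT : ∀ x ∈ P, ∀ t ∈ T, B x t = 0)
    (hP : ∀ x ∈ P, ∀ y ∈ P, B x y = 0) :
    Function.Injective (B.domRestrict₁₂ P N) := by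
  refine (injective_iff_map_eq_zero _).mpr fun x hx ↦ Subtype.ext (hB x fun y ↦ ?_)
  have hle : T ⊔ (P ⊔ N) ≤ LinearMap.ker (B x) :=
    sup_le (hT x x.2) (sup_le (hP x x.2) fun y hy ↦ LinearMap.congr_fun hx ⟨y, hy⟩)
  exact hle (htop ▸ Submodule.mem_top)

section WeightVectors

variable {K L : Type*} [Field K] [LieRing L] [LieAlgebra K L]
  {T : Submodule K L}

/-- Simultaneous eigenvectors are orthogonal for the Killing form unless their eigenvalues are
opposite. -/
lemma killingForm_eq_zero_of_forall_lie_eq_smul {χ ψ : T →ₗ[K] K} (h : χ ≠ -ψ) {x y : L}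
    (hx : ∀ t : T, ⁅(t : L), x⁆ = χ t • x) (hy : ∀ t : T, ⁅(t : L), y⁆ = ψ t • y) :
    killingForm K L x y = 0 := by
  obtain ⟨t, ht⟩ : ∃ t, χ t + ψ t ≠ 0 := by
    by_contra! hc
    exact h (LinearMap.ext fun t ↦ eq_neg_of_add_eq_zero_left (hc t))
  have key := LieModule.traceForm_apply_lie_apply K L L x (t : L) y
  rw [← lie_skew, hx, hy] at key
  simp only [map_neg, map_smul, LinearMap.neg_apply, LinearMap.smul_apply, smul_eq_mul] at key
  have : (χ t + ψ t) * killingForm K L x y = 0 := by linear_combination -key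
  exact (mul_eq_zero.mp this).resolve_left ht

/-- A simultaneous eigenvector of `T` with nonzero eigenvalue is orthogonal to `T` for the
Killing form, even if `T` is not assumed to be abelian. -/
lemma killingForm_eq_zero_of_mem_of_forall_lie_eq_smul {χ : T →ₗ[K] K} (h : χ ≠ 0) {x : L}
    (hx : ∀ t : T, ⁅(t : L), x⁆ = χ t • x) {t : L} (ht : t ∈ T) :
    killingForm K L x t = 0 := by
  have aux (s : T) (hs : χ s ≠ 0) : killingForm K L x s = 0 := by
    have key := LieModule.traceForm_apply_lie_apply K L L x (s : L) s
    rw [← lie_skew, hx, lie_self] at key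
    simpa [hs] using key
  obtain ⟨s, hs⟩ : ∃ s, χ s ≠ 0 := by
    by_contra! hc
    exact h (LinearMap.ext hc)
  lift t to T using ht
  by_cases htχ : χ t = 0
  · have := aux (t + s) (by simpa [htχ] using hs)
    simpa [aux s hs] using this
  · exact aux t htχ

end WeightVectors

/-- Let `𝔤` be a finite-dimensional complex semisimple Lie algebra with
Cartan subalgebra `𝔱` and root space decomposition `𝔤 = 𝔱 ⊕ ⨁_{β > 0} (𝔤_β ⊕ 𝔤_{−β})`
(the positive roots are indexed by `ι`, `gp i = 𝔤_{α i}` and `gn i = 𝔤_{−α i}`).  If `τ` is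
an automorphism of `𝔤` preserving `𝔱` and permuting the positive roots (via `σ`), then the
determinant of the restriction of `τ` to `V = ⨁_{β>0} (𝔤_β ⊕ 𝔤_{−β})` equals `1`, so that
`det (τ on 𝔤)` equals `det (τ restricted to 𝔱)`. -/
theorem det_restriction_to_root_spaces {𝔤 : Type*} [LieRing 𝔤] [LieAlgebra ℂ 𝔤]
    [Module.Finite ℂ 𝔤] [LieAlgebra.IsSemisimple ℂ 𝔤]
    (𝔱 : Submodule ℂ 𝔤) {ι : Type*} [Fintype ι] [DecidableEq ι]
    (α : ι → (𝔱 →ₗ[ℂ] ℂ)) (gp gn : ι → Submodule ℂ 𝔤)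
    -- the roots are nonzero, pairwise distinct, and positive roots are not
    -- negatives of one another
    (hα0 : ∀ i, α i ≠ 0)
    (hdist : ∀ i j, α i = α j → i = j)
    (hpos : ∀ i j, α i ≠ -α j)
    -- `gp i` and `gn i` are the root spaces for the roots `α i` and `−α i`
    (hgp : ∀ (i : ι) (X : 𝔤), X ∈ gp i ↔ ∀ Hh : 𝔱, ⁅(Hh : 𝔤), X⁆ = α i Hh • X)
    (hgn : ∀ (i : ι) (X : 𝔤), X ∈ gn i ↔ ∀ Hh : 𝔱, ⁅(Hh : 𝔤), X⁆ = -(α i Hh) • X)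
    -- the root space decomposition `𝔤 = 𝔱 ⊕ ⨁ (𝔤_β ⊕ 𝔤_{−β})`
    (hdec : DirectSum.IsInternal
      (fun x : Option (ι × Bool) => x.elim 𝔱 fun p => if p.2 then gp p.1 else gn p.1))
    -- `τ` is an automorphism of `𝔤` preserving `𝔱` and permuting the positive roots via `σ`
    (τ : 𝔤 ≃ₗ⁅ℂ⁆ 𝔤) (σ : Equiv.Perm ι)
    (hτ𝔱 : ∀ x ∈ 𝔱, (τ.toLinearEquiv : 𝔤 →ₗ[ℂ] 𝔤) x ∈ 𝔱)
    (hτp : ∀ i, Submodule.map (τ.toLinearEquiv : 𝔤 →ₗ[ℂ] 𝔤) (gp i) = gp (σ i))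
    (hτn : ∀ i, Submodule.map (τ.toLinearEquiv : 𝔤 →ₗ[ℂ] 𝔤) (gn i) = gn (σ i)) :
    ∀ hV : ∀ x ∈ ⨆ i, gp i ⊔ gn i, (τ.toLinearEquiv : 𝔤 →ₗ[ℂ] 𝔤) x ∈ ⨆ i, gp i ⊔ gn i,
      LinearMap.det ((τ.toLinearEquiv : 𝔤 →ₗ[ℂ] 𝔤).restrict hV) = 1 ∧
      LinearMap.det (τ.toLinearEquiv : 𝔤 →ₗ[ℂ] 𝔤) =
        LinearMap.det ((τ.toLinearEquiv : 𝔤 →ₗ[ℂ] 𝔤).restrict hτ𝔱) := by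
  intro hV
  set T : 𝔤 →ₗ[ℂ] 𝔤 := (τ.toLinearEquiv : 𝔤 →ₗ[ℂ] 𝔤)
  have hmap (g : ι → Submodule ℂ 𝔤) (hg : ∀ i, Submodule.map T (g i) = g (σ i)) :
      ∀ x ∈ ⨆ i, g i, T x ∈ ⨆ i, g i := by
    refine fun x hx ↦ (?_ : (⨆ i, g i).map T ≤ ⨆ i, g i) (Submodule.mem_map_of_mem hx)
    rw [Submodule.map_iSup]
    exact iSup_le fun i ↦ hg i ▸ le_iSup g (σ i)
  have hP := hmap gp hτp
  have hN := hmap gn hτn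
  have hsup : (⨆ i, gp i) ⊔ (⨆ i, gn i) = ⨆ i, gp i ⊔ gn i := iSup_sup_eq.symm
  have hind := hdec.submodule_iSupIndep
  have hPN : Disjoint (⨆ i, gp i) (⨆ i, gn i) := by
    refine (hind.disjoint_biSup_biSup (s := {x | ∃ i, x = some (i, true)})
      (t := {x | ∃ i, x = some (i, false)}) ?_).mono
      (iSup_le fun i ↦ le_iSup₂_of_le (some (i, true)) ⟨i, rfl⟩ (by simp))
      (iSup_le fun i ↦ le_iSup₂_of_le (some (i, false)) ⟨i, rfl⟩ (by simp))
    rw [Set.disjoint_left]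
    rintro _ ⟨i, rfl⟩ ⟨j, hj⟩
    simp at hj
  have hTV : Disjoint 𝔱 (⨆ i, gp i ⊔ gn i) := by
    refine (hind none).mono_right (iSup_le fun i ↦ sup_le ?_ ?_)
    · exact le_iSup₂_of_le (some (i, true)) (by simp) (by simp)
    · exact le_iSup₂_of_le (some (i, false)) (by simp) (by simp)
  have htop : 𝔱 ⊔ (⨆ i, gp i ⊔ gn i) = ⊤ := by
    rw [eq_top_iff, ← hdec.submodule_iSup_eq_top]
    refine iSup_le ?_
    rintro (_ | ⟨i, _ | _⟩)
    · exact le_sup_left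
    · exact le_sup_of_le_right (le_iSup_of_le i (by simp))
    · exact le_sup_of_le_right (le_iSup_of_le i (by simp))
  have hgn' (i : ι) (X : 𝔤) (hX : X ∈ gn i) (H : 𝔱) : ⁅(H : 𝔤), X⁆ = (-α i) H • X := by
    simpa using (hgn i X).mp hX H
  let κ := killingForm ℂ 𝔤
  have hκT {g : ι → Submodule ℂ 𝔤} {χ : ι → (𝔱 →ₗ[ℂ] ℂ)} (h0 : ∀ i, χ i ≠ 0)
      (hg : ∀ i, ∀ X ∈ g i, ∀ H : 𝔱, ⁅(H : 𝔤), X⁆ = χ i H • X) :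
      ∀ X ∈ ⨆ i, g i, ∀ H ∈ 𝔱, κ X H = 0 := fun X hX H hH ↦
    κ.apply_eq_zero_of_mem_iSup (t := fun _ : Unit ↦ 𝔱) (fun i _ X hX H hH ↦
      killingForm_eq_zero_of_mem_of_forall_lie_eq_smul (h0 i) (hg i X hX) hH) hX (by simpa using hH)
  have hκ {g : ι → Submodule ℂ 𝔤} {χ : ι → (𝔱 →ₗ[ℂ] ℂ)} (h0 : ∀ i j, χ i ≠ -χ j)
      (hg : ∀ i, ∀ X ∈ g i, ∀ H : 𝔱, ⁅(H : 𝔤), X⁆ = χ i H • X) :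
      ∀ X ∈ ⨆ i, g i, ∀ Y ∈ ⨆ i, g i, κ X Y = 0 := fun X hX Y hY ↦
    κ.apply_eq_zero_of_mem_iSup (fun i j X hX Y hY ↦
      killingForm_eq_zero_of_forall_lie_eq_smul (h0 i j) (hg i X hX) (hg j Y hY)) hX hY
  have hgp' (i : ι) (X : 𝔤) (hX : X ∈ gp i) := (hgp i X).mp hX
  have hκs : κ.SeparatingLeft := (LieAlgebra.IsKilling.killingForm_nondegenerate ℂ 𝔤).1
  have hdet : LinearMap.det (T.restrict hV) = 1 := by
    rw [T.det_restrict_sup_eq_mul hPN hsup hP hN hV]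
    let B := κ.domRestrict₁₂ (⨆ i, gp i) (⨆ i, gn i)
    have : B.IsPerfPair := by
      refine .of_injective ?_ ?_
      · exact hκs.injective_domRestrict₁₂ (hsup ▸ htop) (hκT hα0 hgp') (hκ hpos hgp')
      · have hflip : B.flip = κ.domRestrict₁₂ (⨆ i, gn i) (⨆ i, gp i) := by
          ext x y
          exact LieModule.traceForm_comm ℂ 𝔤 𝔤 _ _
        rw [hflip]
        refine hκs.injective_domRestrict₁₂ (by rwa [sup_comm (⨆ i, gn i), hsup])
          (hκT (fun i ↦ neg_ne_zero.mpr (hα0 i)) hgn') (hκ (fun i j h ↦ ?_) hgn')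
        exact hpos i j (by simpa using congrArg Neg.neg h)
    refine LinearMap.IsPerfPair.det_mul_det_eq_one B _ _ fun x y ↦ ?_
    exact LieAlgebra.killingForm_of_equiv_apply τ (x : 𝔤) (y : 𝔤)
  refine ⟨hdet, ?_⟩
  have hfull := T.det_restrict_sup_eq_mul hTV htop hτ𝔱 hV (fun _ _ ↦ Submodule.mem_top)
  rw [hdet, mul_one] at hfull
  rw [← hfull, ← LinearMap.det_conj _ (Submodule.topEquiv (R := ℂ) (M := 𝔤))]
  rfl
end
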